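/- Let N_{p,q}(x) be the 3×3 fundamental matrix of the third order measure differential equation i d(y')• + 2iq y' dx + y(i dq + dp) = λ y dx, whose columns are (y_j, y_j', (y_j')•) with N_{p,q}(0) = I₃. Then det N_{p,q}(x) = 1 for all x ∈ [0,1]. -/

import Mathlib

open Set Filter Topology

/-- Riemann–Stieltjes integral of `g` with respect to `f` over `[a,b]`,
defined as the limit of left-tagged uniform-partition Riemann–Stieltjes sums. -/
noncomputable def RS (g f : ℝ → ℝ) (a b : ℝ) : ℝ :=
  limUnder Filter.atTop (fun n : ℕ =>
    ∑ i ∈ Finset.range n,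
      g (a + (i : ℝ) * (b - a) / n) *
        (f (a + ((i : ℝ) + 1) * (b - a) / n) - f (a + (i : ℝ) * (b - a) / n)))

/-- Complex-valued Riemann–Stieltjes integral over `[a,b]`. -/
noncomputable def RSC (g f : ℝ → ℂ) (a b : ℝ) : ℂ :=
  limUnder Filter.atTop (fun n : ℕ =>
    ∑ i ∈ Finset.range n,
      g (a + (i : ℝ) * (b - a) / n) *
        (f (a + ((i : ℝ) + 1) * (b - a) / n) - f (a + (i : ℝ) * (b - a) / n)))

/-- Membership in `M₀([0,1],ℝ)`: normalized (vanishing at `0`), right-continuous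
on `(0,1)`, of bounded variation on `[0,1]`. -/
def MemM0 (f : ℝ → ℝ) : Prop :=
  f 0 = 0 ∧
  (∀ x ∈ Set.Ioo (0 : ℝ) 1, Filter.Tendsto f (nhdsWithin x (Set.Ioi x)) (nhds (f x))) ∧
  eVariationOn f (Set.Icc 0 1) ≠ ⊤
/-- The complex measure-coefficient `μ(t) = q(t) - i p(t) + λ i t`. -/
noncomputable def muCoef (p q : ℝ → ℝ) (lam : ℂ) : ℝ → ℂ :=
  fun t => (q t : ℂ) - Complex.I * (p t : ℂ) + lam * Complex.I * (t : ℂ)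

/-- `y` (with `y' = z`, `(y')• = w`) is a solution of the third order measure
differential equation `i d(y')• + 2iq y' dx + y (i dq + dp) = λ y dx` on `[0,1]`,
in the Lebesgue–Stieltjes integral-equation sense. -/
noncomputable def IsSolution (p q : ℝ → ℝ) (lam : ℂ) (y z w : ℝ → ℂ) : Prop :=
  ContinuousOn z (Set.Icc 0 1) ∧
  (∀ x ∈ Set.Icc (0 : ℝ) 1, y x = y 0 + ∫ t in (0:ℝ)..x, z t) ∧
  (∀ x ∈ Set.Icc (0 : ℝ) 1, z x = z 0 + ∫ t in (0:ℝ)..x, w t) ∧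
  (∀ x ∈ Set.Ioc (0 : ℝ) 1,
    w x = w 0 - (∫ t in (0:ℝ)..x, 2 * (q t : ℂ) * z t) - RSC y (muCoef p q lam) 0 x)

open MeasureTheory in
lemma aux_hasDerivAt (f Y : ℝ → ℂ) (c : ℂ) (hf : IntervalIntegrable f volume 0 1)
    (hY : ∀ x ∈ Icc (0:ℝ) 1, Y x = c + ∫ t in (0:ℝ)..x, f t) :
    ContinuousOn Y (Icc 0 1) ∧
      ∀ x ∈ Ioo (0:ℝ) 1, ContinuousAt f x → HasDerivAt Y (f x) x := by
  constructor
  · have h := intervalIntegral.continuousOn_primitive_interval' (a := (0:ℝ)) hf (by simp)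
    rw [uIcc_of_le zero_le_one] at h
    exact (continuousOn_const.add h).congr hY
  · intro x hx hc
    have hsub : IntervalIntegrable f volume 0 x :=
      hf.mono_set (uIcc_subset_uIcc (by simp) (by
        rw [uIcc_of_le zero_le_one]; exact ⟨hx.1.le, hx.2.le⟩))
    have hm : StronglyMeasurableAtFilter f (𝓝 x) :=
      AEStronglyMeasurable.stronglyMeasurableAtFilter_of_mem (s := Ioc 0 1)
        hf.1.aestronglyMeasurable (Ioc_mem_nhds hx.1 hx.2)
    have h := intervalIntegral.integral_hasDerivAt_right hsub hm hc
    refine (h.const_add c).congr_of_eventuallyEq ?_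
    filter_upwards [Ioo_mem_nhds hx.1 hx.2] with t ht
    exact hY t ⟨ht.1.le, ht.2.le⟩

open MeasureTheory in
lemma aux_RSC (y z μ : ℝ → ℂ) (V : ℝ → ℝ) (hz : ContinuousOn z (Icc 0 1))
    (hy : ∀ x ∈ Icc (0 : ℝ) 1, y x = y 0 + ∫ t in (0:ℝ)..x, z t)
    (hμ : IntervalIntegrable μ volume 0 1)
    (hV : ∀ a ∈ Icc (0:ℝ) 1, ∀ b ∈ Icc (0:ℝ) 1, a ≤ b → ‖μ b - μ a‖ ≤ V b - V a)
    (x : ℝ) (hx : x ∈ Ioc (0:ℝ) 1) :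
    RSC y μ 0 x = y x * μ x - y 0 * μ 0 - ∫ t in (0:ℝ)..x, z t * μ t := by
  obtain ⟨Z, hZ⟩ := isCompact_Icc.exists_bound_of_continuousOn hz
  have hZ0 : 0 ≤ Z := (norm_nonneg _).trans (hZ 0 (by simp))
  have hzi : IntervalIntegrable z volume 0 1 := by
    apply ContinuousOn.intervalIntegrable
    rwa [uIcc_of_le zero_le_one]
  have hzμ : IntervalIntegrable (fun t => z t * μ t) volume 0 1 := by
    apply hμ.continuousOn_mul
    rwa [uIcc_of_le zero_le_one]
  have hmono : ∀ {f : ℝ → ℂ}, IntervalIntegrable f volume 0 1 → ∀ a ∈ Icc (0:ℝ) 1,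
      ∀ b ∈ Icc (0:ℝ) 1, IntervalIntegrable f volume a b := by
    intro f hf a ha b hb
    refine hf.mono_set (uIcc_subset_uIcc ?_ ?_) <;> rwa [uIcc_of_le zero_le_one]
  unfold RSC
  apply Tendsto.limUnder_eq
  rw [tendsto_iff_norm_sub_tendsto_zero]
  have hlim : Tendsto (fun n : ℕ => (Z * (V x - V 0) * x) / (n:ℝ)) atTop (𝓝 0) :=
    tendsto_const_div_atTop_nhds_zero_nat _
  refine squeeze_zero' (Eventually.of_forall fun n => norm_nonneg _) ?_ hlim
  filter_upwards [eventually_ge_atTop 1] with n hn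
  have hn0 : (0:ℝ) < n := by exact_mod_cast hn
  let t : ℕ → ℝ := fun i => 0 + (i:ℝ) * (x - 0) / n
  have ht0 : t 0 = 0 := by simp [t]
  have htn : t n = x := by simp only [t]; field_simp; ring
  have hts : ∀ i, t (i+1) = 0 + ((i:ℝ) + 1) * (x - 0) / n := by intro i; simp [t]
  have hd : ∀ i, t (i+1) - t i = x / n := by intro i; rw [hts]; simp only [t]; ring
  have hxn : 0 ≤ x / n := div_nonneg hx.1.le hn0.le
  have htm : ∀ i, i ≤ n → t i ∈ Icc (0:ℝ) 1 := by
    intro i hi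
    have hi' : (i:ℝ) ≤ n := by exact_mod_cast hi
    refine ⟨?_, ?_⟩
    · simp only [t, sub_zero, zero_add]
      exact div_nonneg (mul_nonneg (Nat.cast_nonneg i) hx.1.le) hn0.le
    · simp only [t, sub_zero, zero_add]
      rw [div_le_one hn0]
      have := hx.2
      have := hx.1
      nlinarith
  have hsum : (∑ i ∈ Finset.range n,
      y (0 + (i : ℝ) * (x - 0) / n) *
        (μ (0 + ((i : ℝ) + 1) * (x - 0) / n) - μ (0 + (i : ℝ) * (x - 0) / n)))
      = ∑ i ∈ Finset.range n, y (t i) * (μ (t (i+1)) - μ (t i)) := by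
    refine Finset.sum_congr rfl fun i _ => ?_
    rw [hts]
  rw [hsum]
  have hI : ∫ s in (0:ℝ)..x, z s * μ s
      = ∑ i ∈ Finset.range n, ∫ s in (t i)..(t (i+1)), z s * μ s := by
    rw [intervalIntegral.sum_integral_adjacent_intervals, ht0, htn]
    intro k hk
    exact hmono hzμ _ (htm k hk.le) _ (htm (k+1) hk)
  have htel : y x * μ x - y 0 * μ 0
      = ∑ i ∈ Finset.range n, (y (t (i+1)) * μ (t (i+1)) - y (t i) * μ (t i)) := by
    rw [Finset.sum_range_sub (fun i => y (t i) * μ (t i)), ht0, htn]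
  rw [hI, htel, ← Finset.sum_sub_distrib, ← Finset.sum_sub_distrib]
  have hterm : ∀ i ∈ Finset.range n,
      ‖y (t i) * (μ (t (i+1)) - μ (t i)) - (y (t (i+1)) * μ (t (i+1)) - y (t i) * μ (t i)
        - ∫ s in (t i)..(t (i+1)), z s * μ s)‖ ≤ (Z * (x / n)) * (V (t (i+1)) - V (t i)) := by
    intro i hi
    have hi' := Finset.mem_range.1 hi
    have m1 := htm i hi'.le
    have m2 := htm (i+1) hi'
    have hle : t i ≤ t (i+1) := by have := hd i; linarith
    have hyd : y (t (i+1)) - y (t i) = ∫ s in (t i)..(t (i+1)), z s := by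
      rw [hy _ m1, hy _ m2,
        ← intervalIntegral.integral_interval_sub_left (hmono hzi 0 (by simp) _ m2)
          (hmono hzi 0 (by simp) _ m1)]
      ring
    have e : y (t i) * (μ (t (i+1)) - μ (t i)) - (y (t (i+1)) * μ (t (i+1)) - y (t i) * μ (t i)
        - ∫ s in (t i)..(t (i+1)), z s * μ s)
        = ∫ s in (t i)..(t (i+1)), (z s * μ s - z s * μ (t (i+1))) := by
      rw [intervalIntegral.integral_sub (hmono hzμ _ m1 _ m2)
        ((hmono hzi _ m1 _ m2).mul_const _), intervalIntegral.integral_mul_const, ← hyd]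
      ring
    rw [e]
    refine (intervalIntegral.norm_integral_le_of_norm_le_const
      (C := Z * (V (t (i+1)) - V (t i))) ?_).trans (le_of_eq ?_)
    · intro s hs
      rw [uIoc_of_le hle] at hs
      have ms : s ∈ Icc (0:ℝ) 1 := ⟨m1.1.trans hs.1.le, hs.2.trans m2.2⟩
      rw [← mul_sub, norm_mul, norm_sub_rev]
      have h1 := hV s ms _ m2 hs.2
      have h2 := (norm_nonneg _).trans (hV _ m1 s ms hs.1.le)
      exact mul_le_mul (hZ s ms) (by linarith) (norm_nonneg _) hZ0
    · rw [hd, abs_of_nonneg hxn]; ring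
  refine (norm_sum_le _ _).trans ((Finset.sum_le_sum hterm).trans (le_of_eq ?_))
  rw [← Finset.mul_sum, Finset.sum_range_sub (fun i => V (t i)), ht0, htn]
  ring

open MeasureTheory in
lemma aux_solution (p q : ℝ → ℝ) (lam : ℂ) (y z w : ℝ → ℂ) (V : ℝ → ℝ)
    (hq : IntervalIntegrable (fun t => (q t : ℂ)) volume 0 1)
    (hμ : IntervalIntegrable (muCoef p q lam) volume 0 1)
    (hμ0 : muCoef p q lam 0 = 0)
    (hV : ∀ a ∈ Icc (0:ℝ) 1, ∀ b ∈ Icc (0:ℝ) 1, a ≤ b →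
      ‖muCoef p q lam b - muCoef p q lam a‖ ≤ V b - V a)
    (h : IsSolution p q lam y z w) :
    ∃ u : ℝ → ℂ, (∀ x ∈ Icc (0:ℝ) 1, w x = u x - muCoef p q lam x * y x) ∧
      ContinuousOn y (Icc 0 1) ∧ ContinuousOn z (Icc 0 1) ∧ ContinuousOn u (Icc 0 1) ∧
      ∀ x ∈ Ioo (0:ℝ) 1, ContinuousAt q x → ContinuousAt (muCoef p q lam) x →
        HasDerivAt y (z x) x ∧ HasDerivAt z (u x - muCoef p q lam x * y x) x ∧
        HasDerivAt u ((muCoef p q lam x - 2 * (q x : ℂ)) * z x) x := by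
  obtain ⟨hz, hy, hzw, hw⟩ := h
  set μ := muCoef p q lam with hμdef
  have hzi : IntervalIntegrable z volume 0 1 := by
    apply ContinuousOn.intervalIntegrable
    rwa [uIcc_of_le zero_le_one]
  have hz' : ContinuousOn z (uIcc 0 1) := by rwa [uIcc_of_le zero_le_one]
  obtain ⟨yc, yd⟩ := aux_hasDerivAt z y (y 0) hzi hy
  have hqz : IntervalIntegrable (fun t => 2 * (q t : ℂ) * z t) volume 0 1 :=
    (hq.const_mul 2).mul_continuousOn hz'
  have hzμ : IntervalIntegrable (fun t => z t * μ t) volume 0 1 := hμ.continuousOn_mul hz'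
  have hg : IntervalIntegrable (fun t => (μ t - 2 * (q t : ℂ)) * z t) volume 0 1 :=
    (hμ.sub (hq.const_mul 2)).mul_continuousOn hz'
  let u : ℝ → ℂ := fun x => w 0 + ∫ t in (0:ℝ)..x, (μ t - 2 * (q t : ℂ)) * z t
  have hwu : ∀ x ∈ Icc (0:ℝ) 1, w x = u x - μ x * y x := by
    intro x hx
    rcases hx.1.eq_or_lt with h0 | h0
    · subst h0
      simp [u, hμ0]
    · have hsub : ∀ {f : ℝ → ℂ}, IntervalIntegrable f volume 0 1 →
          IntervalIntegrable f volume 0 x := by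
        intro f hf
        refine hf.mono_set (uIcc_subset_uIcc (by simp) ?_)
        rwa [uIcc_of_le zero_le_one]
      rw [hw x ⟨h0, hx.2⟩, aux_RSC y z μ V hz hy hμ hV x ⟨h0, hx.2⟩, hμ0]
      have : ∫ t in (0:ℝ)..x, (μ t - 2 * (q t : ℂ)) * z t
          = (∫ t in (0:ℝ)..x, z t * μ t) - ∫ t in (0:ℝ)..x, 2 * (q t : ℂ) * z t := by
        rw [← intervalIntegral.integral_sub (hsub hzμ) (hsub hqz)]
        congr 1; ext t; ring
      simp only [u]
      rw [this]; ring
  obtain ⟨uc, ud⟩ := aux_hasDerivAt _ u (w 0) hg (fun x _ => rfl)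
  have hF : IntervalIntegrable (fun x => u x - μ x * y x) volume 0 1 := by
    refine IntervalIntegrable.sub (ContinuousOn.intervalIntegrable ?_)
      (hμ.mul_continuousOn ?_) <;> rwa [uIcc_of_le zero_le_one]
  have hzF : ∀ x ∈ Icc (0:ℝ) 1, z x = z 0 + ∫ t in (0:ℝ)..x, (u t - μ t * y t) := by
    intro x hx
    rw [hzw x hx]
    congr 1
    apply intervalIntegral.integral_congr
    intro t ht
    rw [uIcc_of_le hx.1] at ht
    exact hwu t ⟨ht.1, ht.2.trans hx.2⟩
  obtain ⟨-, zd⟩ := aux_hasDerivAt _ z (z 0) hF hzF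
  refine ⟨u, hwu, yc, hz, uc, ?_⟩
  intro x hx hqc hμc
  have nb : Icc (0:ℝ) 1 ∈ 𝓝 x := Icc_mem_nhds hx.1 hx.2
  have zc := hz.continuousAt nb
  have yc' := yc.continuousAt nb
  have uc' := uc.continuousAt nb
  have hqc' : ContinuousAt (fun t => (q t : ℂ)) x :=
    Complex.continuous_ofReal.continuousAt.comp hqc
  exact ⟨yd x hx zc, zd x hx (uc'.sub (hμc.mul yc')),
    ud x hx ((hμc.sub (continuousAt_const.mul hqc')).mul zc)⟩

open MeasureTheory in
lemma aux_BV (f : ℝ → ℝ) (hf : MemM0 f) : ∃ V : ℝ → ℝ, ∃ s : Set ℝ, s.Countable ∧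
    (∀ a ∈ Icc (0:ℝ) 1, ∀ b ∈ Icc (0:ℝ) 1, a ≤ b → |f b - f a| ≤ V b - V a) ∧
    IntervalIntegrable (fun t => (f t : ℂ)) volume 0 1 ∧
    (∀ x ∈ Ioo (0:ℝ) 1, x ∉ s → ContinuousAt f x) := by
  have hb : BoundedVariationOn f (Icc 0 1) := hf.2.2
  obtain ⟨g, h, hg, hh, rfl⟩ := hb.locallyBoundedVariationOn.exists_monotoneOn_sub_monotoneOn
  refine ⟨g + h, _, (hg.countable_not_continuousWithinAt).union
    (hh.countable_not_continuousWithinAt), ?_, ?_, ?_⟩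
  · intro a ha b hb hab
    have h1 := hg ha hb hab
    have h2 := hh ha hb hab
    simp only [Pi.sub_apply, Pi.add_apply]
    rw [abs_le]; constructor <;> linarith
  · rw [← uIcc_of_le zero_le_one] at hg hh
    have := hg.intervalIntegrable (μ := volume) |>.sub (hh.intervalIntegrable (μ := volume))
    exact ⟨this.1.ofReal, this.2.ofReal⟩
  · intro x hx hxs
    have nb : Icc (0:ℝ) 1 ∈ 𝓝 x := Icc_mem_nhds hx.1 hx.2
    have hxm := mem_of_mem_nhds nb
    simp only [mem_union, mem_ofPred_eq, not_or, not_and, not_not] at hxs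
    exact ((hxs.1 hxm).continuousAt nb).sub ((hxs.2 hxm).continuousAt nb)

/-- Liouville formula: the fundamental matrix `N_{p,q}(x)` whose columns are the
fundamental solutions `(y_j, y_j', (y_j')•)` with `N_{p,q}(0) = I₃` has determinant `1`. -/
theorem det_fundamental_matrix_eq_one
    (p q : ℝ → ℝ) (hp : MemM0 p) (hq : MemM0 q) (lam : ℂ)
    (y₁ z₁ w₁ y₂ z₂ w₂ y₃ z₃ w₃ : ℝ → ℂ)
    (h1 : IsSolution p q lam y₁ z₁ w₁) (h1i : y₁ 0 = 1 ∧ z₁ 0 = 0 ∧ w₁ 0 = 0)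
    (h2 : IsSolution p q lam y₂ z₂ w₂) (h2i : y₂ 0 = 0 ∧ z₂ 0 = 1 ∧ w₂ 0 = 0)
    (h3 : IsSolution p q lam y₃ z₃ w₃) (h3i : y₃ 0 = 0 ∧ z₃ 0 = 0 ∧ w₃ 0 = 1) :
    ∀ x ∈ Icc (0 : ℝ) 1,
      Matrix.det !![y₁ x, y₂ x, y₃ x; z₁ x, z₂ x, z₃ x; w₁ x, w₂ x, w₃ x] = 1 := by
  obtain ⟨Vp, sp, csp, hVp, ip, cp⟩ := aux_BV p hp
  obtain ⟨Vq, sq, csq, hVq, iq, cq⟩ := aux_BV q hq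
  have hμ : IntervalIntegrable (muCoef p q lam) MeasureTheory.volume 0 1 :=
    (iq.sub (ip.const_mul Complex.I)).add
      (Continuous.intervalIntegrable (by fun_prop) _ _)
  have hμ0 : muCoef p q lam 0 = 0 := by simp [muCoef, hp.1, hq.1]
  have hV : ∀ a ∈ Icc (0:ℝ) 1, ∀ b ∈ Icc (0:ℝ) 1, a ≤ b →
      ‖muCoef p q lam b - muCoef p q lam a‖ ≤
        (fun t => Vq t + Vp t + ‖lam‖ * t) b - (fun t => Vq t + Vp t + ‖lam‖ * t) a := by
    intro a ha b hb hab
    have e : muCoef p q lam b - muCoef p q lam a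
        = ((q b - q a : ℝ) : ℂ) - Complex.I * ((p b - p a : ℝ) : ℂ)
          + lam * Complex.I * ((b - a : ℝ) : ℂ) := by
      simp only [muCoef]; push_cast; ring
    rw [e]
    have h1 := hVp a ha b hb hab
    have h2 := hVq a ha b hb hab
    refine (norm_add_le _ _).trans ((add_le_add_left (norm_sub_le _ _) _).trans ?_)
    simp only [norm_mul, Complex.norm_I, Complex.norm_real, Real.norm_eq_abs, one_mul, mul_one]
    rw [abs_of_nonneg (sub_nonneg.2 hab)]
    linarith
  obtain ⟨u₁, hw1, yc1, zc1, uc1, d1⟩ := aux_solution p q lam y₁ z₁ w₁ _ iq hμ hμ0 hV h1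
  obtain ⟨u₂, hw2, yc2, zc2, uc2, d2⟩ := aux_solution p q lam y₂ z₂ w₂ _ iq hμ hμ0 hV h2
  obtain ⟨u₃, hw3, yc3, zc3, uc3, d3⟩ := aux_solution p q lam y₃ z₃ w₃ _ iq hμ hμ0 hV h3
  set D : ℝ → ℂ := fun x => y₁ x * (z₂ x * u₃ x - z₃ x * u₂ x)
    - y₂ x * (z₁ x * u₃ x - z₃ x * u₁ x) + y₃ x * (z₁ x * u₂ x - z₂ x * u₁ x) with hD
  have hdet : ∀ x ∈ Icc (0:ℝ) 1,
      Matrix.det !![y₁ x, y₂ x, y₃ x; z₁ x, z₂ x, z₃ x; w₁ x, w₂ x, w₃ x] = D x := by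
    intro x hx
    rw [Matrix.det_fin_three, hw1 x hx, hw2 x hx, hw3 x hx]
    simp [hD]
    ring
  have hDc : ContinuousOn D (Icc 0 1) := by fun_prop
  intro x hx
  have hI := MeasureTheory.integral_eq_of_hasDerivAt_off_countable_of_le D (fun _ => 0) hx.1
    (csp.union csq) (hDc.mono (Icc_subset_Icc_right hx.2)) (by
      rintro t ⟨ht, hts⟩
      have ht' : t ∈ Ioo (0:ℝ) 1 := ⟨ht.1, ht.2.trans_le hx.2⟩
      rw [mem_union, not_or] at hts
      have hpc := cp t ht' hts.1
      have hqc := cq t ht' hts.2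
      have hμc : ContinuousAt (muCoef p q lam) t := by
        have a1 : ContinuousAt (fun t => (q t : ℂ)) t :=
          Complex.continuous_ofReal.continuousAt.comp hqc
        have a2 : ContinuousAt (fun t => (p t : ℂ)) t :=
          Complex.continuous_ofReal.continuousAt.comp hpc
        unfold muCoef
        fun_prop
      obtain ⟨dy1, dz1, du1⟩ := d1 t ht' hqc hμc
      obtain ⟨dy2, dz2, du2⟩ := d2 t ht' hqc hμc
      obtain ⟨dy3, dz3, du3⟩ := d3 t ht' hqc hμc
      have := ((dy1.mul ((dz2.mul du3).sub (dz3.mul du2))).sub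
        (dy2.mul ((dz1.mul du3).sub (dz3.mul du1)))).add
        (dy3.mul ((dz1.mul du2).sub (dz2.mul du1)))
      convert this using 1
      · rfl
      · simp only [Pi.mul_apply, Pi.sub_apply]
        ring) (by simp)
  have h0 := hdet 0 (by simp)
  rw [hdet x hx]
  have h00 : D 0 = 1 := by
    rw [← h0, Matrix.det_fin_three]
    simp [h1i, h2i, h3i]
  simp only [intervalIntegral.integral_zero] at hI
  rw [← h00]
  exact (sub_eq_zero.1 hI.symm)
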